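/- The recursively defined constants a_r satisfy: 1.55 = a_2 ≤ a_3 ≤ a_4 ≤ …; for every 2 ≤ r ≤ 25, 1.55 ≤ a_r ≤ 1.551; and for every r ≥ 2, 1.55 ≤ a_r ≤ 1.552. -/

import Mathlib

open Filter Real

/-- `fTail ℓ x = e^x − ∑_{i=0}^{ℓ−1} x^i/i!`. -/
noncomputable def fTail (ℓ : ℕ) (x : ℝ) : ℝ :=
  Real.exp x - ∑ i ∈ Finset.range ℓ, x ^ i / (Nat.factorial i : ℝ)

/-- `truncMean ℓ x` is the mean of a Poisson(x) random variable conditioned on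
being at least `ℓ`. -/
noncomputable def truncMean (ℓ : ℕ) (x : ℝ) : ℝ :=
  (∑' i : ℕ, if ℓ ≤ i then (i : ℝ) * x ^ i / (Nat.factorial i : ℝ) else 0) /
  (∑' i : ℕ, if ℓ ≤ i then x ^ i / (Nat.factorial i : ℝ) else 0)

/-- `qProb ℓ r x = r·Pr(Po_{≥ℓ}(x) = r)/λ_ℓ(x)` for `r ≥ ℓ`, and `0` otherwise. -/
noncomputable def qProb (ℓ r : ℕ) (x : ℝ) : ℝ :=
  if ℓ ≤ r then (r : ℝ) * (x ^ r / ((Nat.factorial r : ℝ) * fTail ℓ x)) / truncMean ℓ x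
  else 0

/-- `aAux ar r` is the quantity `a_r'`, i.e. the supremum over `λ > 0` of
`a_r − g(r,λ)/λ_{r+1} + (0.55·λ_1/((1.55^{max(r,3)} − 1)·λ_{r+1}))·[(r+1)q_{r+1,r+1} − r·q_{r,r}]`,
where `ar` stands for the constant `a_r` and
`g(r,λ) = a_r·λ_{r+1}(λ) − (a_r+1)·λ_r(λ) + λ_{r−1}(λ)`. -/
noncomputable def aAux (ar : ℝ) (r : ℕ) : ℝ :=
  sSup {z : ℝ | ∃ l : ℝ, 0 < l ∧
    z = ar - (ar * truncMean (r + 1) l - (ar + 1) * truncMean r l + truncMean (r - 1) l) /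
          truncMean (r + 1) l
        + (0.55 * truncMean 1 l / (((1.55 : ℝ) ^ (max r 3) - 1) * truncMean (r + 1) l)) *
            (((r : ℝ) + 1) * qProb (r + 1) (r + 1) l - (r : ℝ) * qProb r r l)}

/-- The recursively defined constants `a_r`: `a_2 = 1.55`, and
`a_{r+1} = max{a_r, a_r'} + 10^{−5}` for `2 ≤ r ≤ 24`,
`a_{r+1} = max{a_r, a_r'} + 2^{−r}` for `r ≥ 25`. -/
noncomputable def aSeq : ℕ → ℝ
  | 0 => 1.55
  | 1 => 1.55
  | 2 => 1.55
  | (r + 3) =>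
      max (aSeq (r + 2)) (aAux (aSeq (r + 2)) (r + 2)) +
        (if r + 2 ≤ 24 then 1e-5 else ((2 : ℝ)⁻¹) ^ (r + 2))

lemma fTail_succ (n : ℕ) (x : ℝ) :
    fTail (n + 1) x = fTail n x - x ^ n / (Nat.factorial n : ℝ) := by
  simp only [fTail, Finset.sum_range_succ]
  ring

lemma fTail_pos (n : ℕ) {x : ℝ} (hx : 0 < x) : 0 < fTail n x := by
  have h := Real.sum_le_exp_of_nonneg hx.le (n + 1)
  rw [Finset.sum_range_succ] at h
  have : 0 < x ^ n / (Nat.factorial n : ℝ) := by positivity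
  unfold fTail
  linarith

lemma hasSum_fTail (n : ℕ) (x : ℝ) :
    HasSum (fun i : ℕ => if n ≤ i then x ^ i / (Nat.factorial i : ℝ) else 0) (fTail n x) := by
  have h1 : HasSum (fun i : ℕ => x ^ i / (Nat.factorial i : ℝ)) (Real.exp x) := by
    rw [Real.exp_eq_exp_ℝ]
    exact NormedSpace.expSeries_div_hasSum_exp x
  have h2 : HasSum (fun i : ℕ => if i < n then x ^ i / (Nat.factorial i : ℝ) else 0)
      (∑ i ∈ Finset.range n, x ^ i / (Nat.factorial i : ℝ)) := by
    rw [Finset.sum_congr rfl (g := fun i : ℕ => if i < n then x ^ i / (Nat.factorial i : ℝ) else 0)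
      (fun i hi => by simp [Finset.mem_range.mp hi])]
    exact hasSum_sum_of_ne_finset_zero (fun i hi => if_neg (by simpa using hi))
  refine (h1.sub h2).congr_fun fun i => ?_
  by_cases h : n ≤ i
  · simp [h, not_lt.mpr h]
  · simp [h, not_le.mp h]

lemma hasSum_mul_fTail (n : ℕ) (x : ℝ) :
    HasSum (fun i : ℕ => if n + 1 ≤ i then (i : ℝ) * x ^ i / (Nat.factorial i : ℝ) else 0)
      (x * fTail n x) := by
  rw [← hasSum_nat_add_iff' 1, Finset.sum_range_one, if_neg (by omega), sub_zero]
  refine ((hasSum_fTail n x).mul_left x).congr_fun fun i => ?_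
  by_cases h : n ≤ i
  · have : ((i : ℝ) + 1) ≠ 0 := by positivity
    simp only [Nat.add_le_add_iff_right, h, if_true, Nat.factorial_succ]
    push_cast
    field_simp
    ring
  · simp [h]

lemma truncMean_succ (n : ℕ) (x : ℝ) :
    truncMean (n + 1) x = x * fTail n x / fTail (n + 1) x := by
  rw [truncMean, (hasSum_mul_fTail n x).tsum_eq, (hasSum_fTail (n + 1) x).tsum_eq]

lemma natCast_le_truncMean {n : ℕ} (hn : 1 ≤ n) {x : ℝ} (hx : 0 < x) : (n : ℝ) ≤ truncMean n x := by
  obtain ⟨m, rfl⟩ := Nat.exists_eq_add_of_le' hn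
  rw [truncMean_succ, le_div_iff₀ (fTail_pos _ hx)]
  refine hasSum_le (fun i => ?_) ((hasSum_fTail (m + 1) x).mul_left _) (hasSum_mul_fTail m x)
  split_ifs with h
  · rw [mul_div_assoc]
    have : ((m + 1 : ℕ) : ℝ) ≤ i := by exact_mod_cast h
    gcongr
  · simp

lemma lt_truncMean {n : ℕ} (hn : 1 ≤ n) {x : ℝ} (hx : 0 < x) : x < truncMean n x := by
  obtain ⟨m, rfl⟩ := Nat.exists_eq_add_of_le' hn
  rw [truncMean_succ, lt_div_iff₀ (fTail_pos _ hx), fTail_succ]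
  have : 0 < x ^ m / (Nat.factorial m : ℝ) := by positivity
  gcongr
  linarith

/-- The recurrence relating the means at consecutive truncation levels. -/
lemma truncMean_recurrence {n : ℕ} (hn : 1 ≤ n) {x : ℝ} (hx : 0 < x) :
    (n + x - truncMean n x) * truncMean (n + 1) x = n * x := by
  obtain ⟨m, rfl⟩ := Nat.exists_eq_add_of_le' hn
  have h0 := (fTail_pos m hx).ne'
  have h1 := (fTail_pos (m + 1) hx).ne'
  have h2 := (fTail_pos (m + 1 + 1) hx).ne'
  have e1 : x ^ m / (Nat.factorial m : ℝ) = fTail m x - fTail (m + 1) x := by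
    rw [fTail_succ]; ring
  have e2 : (m + 1) * fTail (m + 1 + 1) x
      = (m + 1) * fTail (m + 1) x - x * (x ^ m / (Nat.factorial m : ℝ)) := by
    rw [fTail_succ (m + 1), Nat.factorial_succ]
    push_cast
    field_simp
    ring
  rw [e1] at e2
  rw [truncMean_succ, truncMean_succ]
  push_cast
  field_simp
  linear_combination -e2

lemma truncMean_lt {n : ℕ} (hn : 1 ≤ n) {x : ℝ} (hx : 0 < x) : truncMean n x < n + x := by
  have h := truncMean_recurrence hn hx
  have h1 := hx.trans (lt_truncMean (n := n + 1) (by omega) hx)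
  have hn' : (0 : ℝ) < n := by exact_mod_cast hn
  have : 0 < n * x := by positivity
  rw [← h] at this
  linarith [pos_of_mul_pos_left this h1.le]

lemma qProb_self {n : ℕ} (hn : 1 ≤ n) {x : ℝ} (hx : 0 < x) :
    qProb n n x = 1 - x / truncMean n x := by
  obtain ⟨m, rfl⟩ := Nat.exists_eq_add_of_le' hn
  have h0 := (fTail_pos m hx).ne'
  have h1 := (fTail_pos (m + 1) hx).ne'
  have e1 : x ^ m / (Nat.factorial m : ℝ) = fTail m x - fTail (m + 1) x := by
    rw [fTail_succ]; ring
  have e2 : x ^ m = (fTail m x - fTail (m + 1) x) * (Nat.factorial m : ℝ) := by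
    rw [← e1]; field_simp
  have hm : ((m : ℝ) + 1) ≠ 0 := by positivity
  rw [qProb, if_pos le_rfl, truncMean_succ, Nat.factorial_succ, pow_succ, e2]
  push_cast
  field_simp

lemma truncMean_one_le {x : ℝ} (hx : 0 < x) :
    (x + 2) * truncMean 1 x ≤ x ^ 2 + 2 * x + 2 := by
  have h := Real.quadratic_le_exp_of_nonneg hx.le
  have e0 : fTail 0 x = Real.exp x := by simp [fTail]
  have e1 : fTail (0 + 1) x = Real.exp x - 1 := by simp [fTail]
  have h1 := fTail_pos (0 + 1) hx
  have e2 : truncMean 1 x = x * fTail 0 x / fTail (0 + 1) x := truncMean_succ 0 x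
  rw [e2, mul_div_assoc', div_le_iff₀ h1, e0, e1]
  linarith

/-- If `σ` satisfies the recurrence of the excesses `truncMean k x - k` as an inequality,
then it is a lower bound for them. -/
lemma le_truncMean_sub_of_subsolution {r : ℕ} (hr : 1 ≤ r) {x : ℝ} (hx : 0 < x) {σ : ℕ → ℝ}
    (h0 : ∀ k, 0 ≤ σ k) (h1 : ∀ k, σ k ≤ x)
    (h : ∀ k, r ≤ k → σ k * (k + 1 + σ (k + 1)) ≤ x * (1 + σ (k + 1))) :
    σ r ≤ truncMean r x - r := by
  set E : ℕ → ℝ := fun k => max 0 (σ k - (truncMean k x - k))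
  have hE0 : ∀ k, 0 ≤ E k := fun k => le_max_left _ _
  have hstep : ∀ k, r ≤ k → E k ≤ x / (k + 1) * E (k + 1) := by
    intro k hk
    have hnn : 0 ≤ x / (k + 1) * E (k + 1) := mul_nonneg (by positivity) (hE0 _)
    refine max_le hnn ?_
    have hrec := truncMean_recurrence (hr.trans hk) hx
    have hs := natCast_le_truncMean (n := k + 1) (by omega) hx
    have hD : σ (k + 1) - (truncMean (k + 1) x - (k + 1 : ℕ)) ≤ E (k + 1) := le_max_right _ _
    have hk' := h k hk
    push_cast at hs hD
    have hσ := h0 (k + 1)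
    have hE' := hE0 (k + 1)
    generalize truncMean (k + 1) x = A at *
    generalize truncMean k x = t at *
    generalize σ (k + 1) = σ' at *
    generalize σ k = σ₀ at *
    generalize E (k + 1) = e at *
    have hk0 : (0 : ℝ) ≤ k := by positivity
    have hA : 0 < A := by linarith
    have hB : (0 : ℝ) < k + 1 + σ' := by linarith
    have hb1 : σ₀ ≤ x * (1 + σ') / (k + 1 + σ') := by rwa [le_div_iff₀ hB]
    have hb2 : t - k = x - k * x / A := by
      field_simp
      linarith
    have hb3 : σ₀ - (t - k) ≤ x * k / (A * (k + 1 + σ')) * (σ' - (A - (k + 1))) := by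
      rw [hb2]
      refine (sub_le_sub_right hb1 _).trans_eq ?_
      field_simp
      ring
    refine hb3.trans ?_
    have hb4 : x * k / (A * (k + 1 + σ')) ≤ x / (k + 1) := by
      rw [div_le_div_iff₀ (by positivity) (by positivity), mul_assoc]
      have : (k : ℝ) * (k + 1) ≤ A * (k + 1 + σ') :=
        mul_le_mul (by linarith) (by linarith) (by positivity) hA.le
      gcongr
    have hc : 0 ≤ x * k / (A * (k + 1 + σ')) := by positivity
    calc _ ≤ x * k / (A * (k + 1 + σ')) * e := by gcongr
      _ ≤ _ := by gcongr
  obtain ⟨N, hN⟩ := exists_nat_ge (2 * x)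
  have hfar : ∀ j k : ℕ, r ≤ k → N ≤ k → E k ≤ x * (1 / 2) ^ j := by
    intro j
    induction j with
    | zero =>
      intro k hk _
      have := natCast_le_truncMean (hr.trans hk) hx
      rw [pow_zero, mul_one]
      exact max_le hx.le (by linarith [h1 k])
    | succ j ih =>
      intro k hk hNk
      have hNk' : (N : ℝ) ≤ k := by exact_mod_cast hNk
      have hhalf : x / (k + 1) ≤ 1 / 2 := by
        rw [div_le_div_iff₀ (by positivity) (by positivity)]
        linarith
      calc E k ≤ x / (k + 1) * E (k + 1) := hstep k hk
        _ ≤ 1 / 2 * (x * (1 / 2) ^ j) :=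
          mul_le_mul hhalf (ih (k + 1) (by omega) (by omega)) (hE0 _) (by norm_num)
        _ = x * (1 / 2) ^ (j + 1) := by ring
  have hzero : E (r + N) ≤ 0 := by
    have hlim : Tendsto (fun j : ℕ => x * (1 / 2 : ℝ) ^ j) atTop (nhds (x * 0)) :=
      (tendsto_pow_atTop_nhds_zero_of_lt_one (by norm_num) (by norm_num)).const_mul x
    rw [mul_zero] at hlim
    exact ge_of_tendsto' hlim fun j => hfar j (r + N) (by omega) (by omega)
  have hback : ∀ m k : ℕ, r ≤ k → E (k + m) ≤ 0 → E k ≤ 0 := by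
    intro m
    induction m with
    | zero => intro k _ hk; simpa using hk
    | succ m ih =>
      intro k hk hm
      have := ih (k + 1) (by omega) (by rwa [show k + 1 + m = k + (m + 1) by omega])
      exact (hstep k hk).trans (mul_nonpos_of_nonneg_of_nonpos (by positivity) this)
  have := (le_max_right _ _).trans (hback N r le_rfl hzero)
  linarith

lemma exists_convexity_root {x : ℝ} (hx : 0 < x) (k : ℕ) :
    ∃ σ : ℝ, 0 < σ ∧ σ ≤ x ∧ x * (1 + σ) = σ * (2 * σ + k + 1) := by
  set b : ℝ := x - k - 1 with hb
  have hD : 0 < b ^ 2 + 8 * x := by positivity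
  have hsq := Real.sq_sqrt hD.le
  have hs0 := Real.sqrt_nonneg (b ^ 2 + 8 * x)
  set w := Real.sqrt (b ^ 2 + 8 * x)
  have hroot : x * (1 + (b + w) / 4) = (b + w) / 4 * (2 * ((b + w) / 4) + k + 1) := by
    rw [show (k : ℝ) = x - b - 1 by rw [hb]; ring]
    linear_combination (-1 / 8) * hsq
  have hpos : 0 < (b + w) / 4 := by
    have : -b < w := by
      by_contra! hcon
      nlinarith
    linarith
  refine ⟨(b + w) / 4, hpos, ?_, hroot⟩
  have hk : (0 : ℝ) ≤ k := by positivity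
  generalize (b + w) / 4 = σ at *
  nlinarith [mul_pos hpos hx]

/-- Convexity of the mean in the truncation level, written for the excess `truncMean r x - r`. -/
lemma truncMean_convex {r : ℕ} (hr : 1 ≤ r) {x : ℝ} (hx : 0 < x) :
    (r + x - truncMean r x) * (1 + (truncMean r x - r))
      ≤ truncMean r x * (truncMean r x - r) := by
  choose σ hpos hle hroot using exists_convexity_root hx
  have key : σ r ≤ truncMean r x - r := by
    refine le_truncMean_sub_of_subsolution hr hx (fun k => (hpos k).le) hle fun k _ => ?_
    have h1 := hroot (k + 1)
    have h0 := hroot k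
    have p1 := hpos (k + 1)
    have p0 := hpos k
    push_cast at h1
    generalize σ (k + 1) = τ at *
    generalize σ k = s at *
    have hk : (0 : ℝ) ≤ k := by positivity
    have hB : 0 < k + 1 + τ := by linarith
    obtain ⟨y, hy⟩ : ∃ y, y * (k + 1 + τ) = x * (1 + τ) := ⟨x * (1 + τ) / (k + 1 + τ), by field_simp⟩
    have hy0 : 0 < y := by
      have : 0 < y * (k + 1 + τ) := by rw [hy]; positivity
      exact pos_of_mul_pos_left this hB.le
    rw [← hy]
    gcongr
    have hlin : y * (k - 1 - τ) ≤ k * τ := by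
      have : (k + 1 + τ) * (k * τ - y * (k - 1 - τ)) = 2 * τ * (1 + τ) ^ 2 := by
        linear_combination (-(k - 1 - τ)) * (hy + h1)
      have hpos' : 0 < (k + 1 + τ) * (k * τ - y * (k - 1 - τ)) := by rw [this]; positivity
      linarith [pos_of_mul_pos_right hpos' hB.le]
    have hQ : x * (1 + y) ≤ y * (2 * y + k + 1) := by
      have : x * (1 + y) * (1 + τ) ≤ y * (2 * y + k + 1) * (1 + τ) := by
        calc x * (1 + y) * (1 + τ) = y * ((k + 1 + τ) * (1 + y)) := by
              linear_combination (-(1 + y)) * hy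
          _ ≤ y * ((2 * y + k + 1) * (1 + τ)) := by
              refine mul_le_mul_of_nonneg_left ?_ hy0.le
              linarith
          _ = _ := by ring
      exact le_of_mul_le_mul_right this (by linarith)
    by_contra! hlt
    have h2 : s * (2 * s + k + 1) * (1 + y) ≤ y * (2 * y + k + 1) * (1 + s) := by
      rw [← h0]
      nlinarith
    have h3 : 0 < (s - y) * (2 * s + 2 * y + k + 1 + 2 * s * y) :=
      mul_pos (by linarith) (by positivity)
    linarith
  have h0 := hroot r
  have p0 := hpos r
  have hs := natCast_le_truncMean hr hx
  generalize σ r = s at *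
  generalize truncMean r x = t at *
  have : 0 ≤ (t - r - s) * (2 * (t - r) * s + x) := by
    apply mul_nonneg <;> nlinarith
  nlinarith

/-- One step of the recurrence, transporting a rational lower bound `P / Q` for the excess at
level `k + 1` to level `k`. -/
lemma truncMean_sub_step {k : ℕ} (hk : 1 ≤ k) {x P Q : ℝ} (hx : 0 < x)
    (h : P ≤ Q * (truncMean (k + 1) x - (k + 1 : ℕ))) :
    x * (P + Q) ≤ ((k + 1) * Q + P) * (truncMean k x - k) := by
  have hrec := truncMean_recurrence hk hx
  have hA := hx.trans (lt_truncMean (n := k + 1) (by omega) hx)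
  push_cast at h
  generalize truncMean (k + 1) x = A at *
  generalize truncMean k x = t at *
  refine le_of_mul_le_mul_right ?_ hA
  have : 0 ≤ x * k * (Q * (A - (k + 1)) - P) :=
    mul_nonneg (by positivity) (by linarith)
  have e : (t - k) * A = x * A - k * x := by linarith
  calc x * (P + Q) * A ≤ ((k + 1) * Q + P) * (x * A - k * x) := by linarith
    _ = _ := by rw [← e]; ring

lemma main_ineq_of_rational_bound {ρ x s l C C' P Q : ℝ} (hρ : 0 < ρ) (hx : 0 < x) (hC : 0 ≤ C)
    (hCC' : C ≤ C') (hP : 0 ≤ P) (hQ : 0 < Q) (hs : P ≤ Q * s) (hsx : s ≤ x)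
    (hl : (x + 2) * l ≤ x ^ 2 + 2 * x + 2)
    (h : (x * Q - P) * ((x + 2) * (Q + P)
        + C' * (x ^ 2 + 2 * x + 2) * (Q + P * ((ρ + 1) / ρ)))
      ≤ 1.55 * ((ρ * Q + P) * P) * (x + 2)) :
    (x - s) * (1 + s + C * l * (1 + s * ((ρ + 1) / ρ))) ≤ 1.55 * ((ρ + s) * s) := by
  obtain ⟨σ, rfl⟩ : ∃ σ, P = Q * σ := ⟨P / Q, by field_simp⟩
  obtain ⟨m, hm⟩ : ∃ m, (x + 2) * m = x ^ 2 + 2 * x + 2 :=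
    ⟨(x ^ 2 + 2 * x + 2) / (x + 2), by field_simp⟩
  have hσs : σ ≤ s := le_of_mul_le_mul_left hs hQ
  have hσ : 0 ≤ σ := nonneg_of_mul_nonneg_right hP hQ
  have hlm : l ≤ m := le_of_mul_le_mul_left (hl.trans_eq hm.symm) (by linarith)
  have hm0 : 0 ≤ m := by
    have : 0 ≤ (x + 2) * m := by rw [hm]; positivity
    exact nonneg_of_mul_nonneg_right this (by linarith)
  set κ : ℝ := (ρ + 1) / ρ
  have hκ0 : 0 ≤ κ := by positivity
  have hC' : 0 ≤ C' := hC.trans hCC'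
  have hs0 : 0 ≤ s := hσ.trans hσs
  have hbase : (x - σ) * (1 + σ + C' * m * (1 + σ * κ)) ≤ 1.55 * ((ρ + σ) * σ) := by
    have hpos : 0 < Q ^ 2 * (x + 2) := by positivity
    refine le_of_mul_le_mul_left ?_ hpos
    rw [← hm] at h
    linarith
  have hCl : C * l ≤ C' * m :=
    (mul_le_mul_of_nonneg_left hlm hC).trans (mul_le_mul_of_nonneg_right hCC' hm0)
  have hreduce : (x - s) * (1 + s + C * l * (1 + s * κ))
      ≤ (x - s) * (1 + s + C' * m * (1 + s * κ)) := by
    have : 0 ≤ x - s := by linarith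
    gcongr
  refine hreduce.trans ?_
  have hγ : 0 ≤ C' * m := mul_nonneg hC' hm0
  generalize C' * m = γ at *
  have hpos : 0 < 1 + σ + γ * (1 + σ * κ) := by positivity
  refine le_of_mul_le_mul_right ?_ hpos
  calc (x - s) * (1 + s + γ * (1 + s * κ)) * (1 + σ + γ * (1 + σ * κ))
      ≤ (x - σ) * (1 + s + γ * (1 + s * κ)) * (1 + σ + γ * (1 + σ * κ)) := by gcongr
    _ = ((x - σ) * (1 + σ + γ * (1 + σ * κ))) * (1 + s + γ * (1 + s * κ)) := by ring
    _ ≤ (1.55 * ((ρ + σ) * σ)) * (1 + s + γ * (1 + s * κ)) := by gcongr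
    _ ≤ 1.55 * ((ρ + s) * s) * (1 + σ + γ * (1 + σ * κ)) := by
      have h1 : 0 ≤ (s - σ) * ((ρ + s + σ) * (1 + γ) + s * σ * (1 + γ * κ)) :=
        mul_nonneg (by linarith) (by positivity)
      linarith

lemma main_ineq_of_convexity {ρ x s l C : ℝ} (hρ : 6 ≤ ρ) (hx : 0 < x)
    (hCC' : C ≤ 11 / (42 * ρ)) (hs : 0 ≤ s) (hsx : s ≤ x) (hxs : x - ρ ≤ s)
    (hl0 : 0 ≤ l) (hl : (x + 2) * l ≤ x ^ 2 + 2 * x + 2)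
    (hconv : (x - s) * (1 + s) ≤ (ρ + s) * s) :
    (x - s) * (1 + s + C * l * (1 + s * ((ρ + 1) / ρ))) ≤ 1.55 * ((ρ + s) * s) := by
  have hρ0 : 0 < ρ := by linarith
  have hd : 0 ≤ x - s := by linarith
  have hlx : l ≤ 1 + x := by
    refine le_of_mul_le_mul_left (hl.trans ?_) (by linarith : 0 < x + 2)
    linarith
  have hmain : (x - s) * ((1 + x) * (ρ + s * (ρ + 1))) ≤ 2.1 * ρ ^ 2 * ((ρ + s) * s) := by
    rcases le_total ((1 + x) * (ρ + 1)) (2.1 * ρ ^ 2) with h | h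
    · calc (x - s) * ((1 + x) * (ρ + s * (ρ + 1)))
          ≤ (x - s) * ((1 + x) * ((ρ + 1) * (1 + s))) := by
            gcongr
            linarith
        _ = ((1 + x) * (ρ + 1)) * ((x - s) * (1 + s)) := by ring
        _ ≤ 2.1 * ρ ^ 2 * ((ρ + s) * s) := by gcongr
    · have h1 : 0.7 * ρ ^ 2 ≤ s * (ρ + 1) := by nlinarith
      have h2 : 0.7 * ρ ^ 2 ≤ 2.1 * ρ ^ 2 - (ρ + 1) ^ 2 := by nlinarith
      have h3 : (ρ + 1) ^ 2 ≤ 0.49 * ρ ^ 3 := by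
        have : (ρ + 1) ^ 2 ≤ 0.49 * (6 * ρ ^ 2) := by nlinarith
        nlinarith [sq_nonneg ρ]
      have h4 : ρ * (ρ + 1) ≤ s * (2.1 * ρ ^ 2 - (ρ + 1) ^ 2) := by
        refine le_of_mul_le_mul_right ?_ (by linarith : 0 < ρ + 1)
        calc ρ * (ρ + 1) * (ρ + 1) = ρ * (ρ + 1) ^ 2 := by ring
          _ ≤ ρ * (0.49 * ρ ^ 3) := by gcongr
          _ = (0.7 * ρ ^ 2) * (0.7 * ρ ^ 2) := by ring
          _ ≤ (s * (ρ + 1)) * (2.1 * ρ ^ 2 - (ρ + 1) ^ 2) := by gcongr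
          _ = _ := by ring
      calc (x - s) * ((1 + x) * (ρ + s * (ρ + 1)))
          ≤ ρ * ((1 + ρ + s) * (ρ + s * (ρ + 1))) := by
            have h5 : x - s ≤ ρ := by linarith
            have h6 : 1 + x ≤ 1 + ρ + s := by linarith
            gcongr
        _ = (ρ * (1 + ρ + s)) * (ρ + s * (ρ + 1)) := by ring
        _ ≤ ((ρ + 1) * (ρ + s)) * (ρ + s * (ρ + 1)) :=
            mul_le_mul_of_nonneg_right (by linarith) (by positivity)
        _ = (ρ + s) * (ρ * (ρ + 1) + s * (ρ + 1) ^ 2) := by ring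
        _ ≤ (ρ + s) * (s * (2.1 * ρ ^ 2 - (ρ + 1) ^ 2) + s * (ρ + 1) ^ 2) := by gcongr
        _ = _ := by ring
  have hterm : (x - s) * (C * l * (1 + s * ((ρ + 1) / ρ))) ≤ 0.55 * ((ρ + s) * s) := by
    calc (x - s) * (C * l * (1 + s * ((ρ + 1) / ρ)))
        ≤ (x - s) * (11 / (42 * ρ) * (1 + x) * (1 + s * ((ρ + 1) / ρ))) := by gcongr
      _ = 11 / (42 * ρ ^ 2) * ((x - s) * ((1 + x) * (ρ + s * (ρ + 1)))) := by
        field_simp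
      _ ≤ 11 / (42 * ρ ^ 2) * (2.1 * ρ ^ 2 * ((ρ + s) * s)) := by gcongr
      _ = _ := by
        field_simp
        ring
  linarith

lemma two_point_one_mul_le_pow {r : ℕ} (hr : 6 ≤ r) : 2.1 * (r : ℝ) ≤ 1.55 ^ r - 1 := by
  induction r, hr using Nat.le_induction with
  | base => norm_num
  | succ n hn ih =>
    have : (6 : ℝ) ≤ n := by exact_mod_cast hn
    push_cast
    rw [pow_succ]
    linarith

lemma bernstein_poly_nonneg {x : ℝ} (h0 : 0 ≤ x) (h7 : x ≤ 7) :
    0 ≤ 11786342 + 8956039 * x + 570548 * x ^ 2 - 298383 * x ^ 3 - 74536 * x ^ 4 - 6398 * x ^ 5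
      + 768 * x ^ 6 + 524 * x ^ 7 + 101 * x ^ 8 + 8 * x ^ 9 := by
  obtain ⟨y, hy⟩ : ∃ y, y = 7 - x := ⟨_, rfl⟩
  have hy0 : 0 ≤ y := by linarith
  have hpos : 0 ≤ 11786342 * y ^ 10 + 180555693 * x * y ^ 9 + 1122572699 * x ^ 2 * y ^ 8 +
      3792592315 * x ^ 3 * y ^ 7 + 7628696089 * x ^ 4 * y ^ 6 + 9104418743 * x ^ 5 * y ^ 5 +
      5617534405 * x ^ 6 * y ^ 4 + 802431449 * x ^ 7 * y ^ 3 + 80101514 * x ^ 8 * y ^ 2 +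
      1721255546 * x ^ 9 * y + 1140562697 * x ^ 10 := by positivity
  refine nonneg_of_mul_nonneg_right (a := (7 : ℝ) ^ 10) ?_ (by norm_num)
  refine hpos.trans_eq ?_
  rw [hy]
  ring

lemma main_ineq {r : ℕ} (hr : 2 ≤ r) {x : ℝ} (hx : 0 < x) :
    (x - (truncMean r x - r)) * (1 + (truncMean r x - r)
        + 0.55 / ((1.55 : ℝ) ^ (max r 3) - 1) * truncMean 1 x
          * (1 + (truncMean r x - r) * (((r : ℝ) + 1) / r)))
      ≤ 1.55 * ((r + (truncMean r x - r)) * (truncMean r x - r)) := by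
  have hr1 : 1 ≤ r := by omega
  have hl := truncMean_one_le hx
  have hl0 : 0 ≤ truncMean 1 x := (hx.trans (lt_truncMean le_rfl hx)).le
  have hlt := truncMean_lt hr1 hx
  have hstart : ∀ n : ℕ, 1 ≤ n → (0 : ℝ) ≤ 1 * (truncMean n x - n) := fun n hn => by
    linarith [natCast_le_truncMean hn hx]
  rcases le_or_gt 6 r with h6 | h6
  · have h6' : (6 : ℝ) ≤ r := by exact_mod_cast h6
    have hK := two_point_one_mul_le_pow h6
    rw [max_eq_left (by omega)]
    refine main_ineq_of_convexity h6' hx ?_ (by linarith [natCast_le_truncMean hr1 hx])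
      (by linarith) (by linarith [lt_truncMean hr1 hx]) hl0 hl ?_
    · rw [div_le_div_iff₀ (by linarith) (by positivity)]
      linarith
    · have := truncMean_convex hr1 hx
      linarith
  · have hcoeff : ∀ n : ℕ, 2 ≤ n → (0 : ℝ) ≤ 0.55 / ((1.55 : ℝ) ^ n - 1) := fun n hn => by
      have : (1 : ℝ) ≤ 1.55 ^ n := one_le_pow₀ (by norm_num)
      exact div_nonneg (by norm_num) (by linarith)
    have hsx : truncMean r x - r ≤ x := by linarith
    interval_cases r
    · have b4 := truncMean_sub_step (k := 4) (by omega) hx (hstart 5 (by omega))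
      have b3 := truncMean_sub_step (k := 3) (by omega) hx b4
      have b2 := truncMean_sub_step (k := 2) (by omega) hx b3
      refine main_ineq_of_rational_bound (C' := 0.202) (by norm_num) hx (hcoeff _ (by norm_num))
        (by norm_num) (by positivity) (by positivity) b2 hsx hl ?_
      rw [← sub_nonneg]
      ring_nf
      positivity
    · rcases le_total x 7 with h7 | h7
      · have b7 := truncMean_sub_step (k := 7) (by omega) hx (hstart 8 (by omega))
        have b6 := truncMean_sub_step (k := 6) (by omega) hx b7
        have b5 := truncMean_sub_step (k := 5) (by omega) hx b6
        have b4 := truncMean_sub_step (k := 4) (by omega) hx b5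
        have b3 := truncMean_sub_step (k := 3) (by omega) hx b4
        refine main_ineq_of_rational_bound (C' := 0.202) (by norm_num) hx (hcoeff _ (by norm_num))
          (by norm_num) (by positivity) (by positivity) b3 hsx hl ?_
        have hp := mul_nonneg hx.le (bernstein_poly_nonneg hx.le h7)
        rw [← sub_nonneg]
        refine (mul_nonneg zero_le_two hp).trans ?_
        rw [← sub_nonneg]
        ring_nf
        positivity
      · have b3 : x - 3 ≤ 1 * (truncMean 3 x - (3 : ℕ)) := by
          push_cast
          linarith [lt_truncMean (n := 3) (by omega) hx]
        refine main_ineq_of_rational_bound (C' := 0.202) (by norm_num) hx (hcoeff _ (by norm_num))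
          (by norm_num) (by linarith) one_pos b3 hsx hl ?_
        obtain ⟨u, rfl⟩ : ∃ u, x = 7 + u := ⟨x - 7, by ring⟩
        have hu : 0 ≤ u := by linarith
        rw [← sub_nonneg]
        ring_nf
        positivity
    · have b7 := truncMean_sub_step (k := 7) (by omega) hx (hstart 8 (by omega))
      have b6 := truncMean_sub_step (k := 6) (by omega) hx b7
      have b5 := truncMean_sub_step (k := 5) (by omega) hx b6
      have b4 := truncMean_sub_step (k := 4) (by omega) hx b5
      refine main_ineq_of_rational_bound (C' := 0.116) (by norm_num) hx (hcoeff _ (by norm_num))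
        (by norm_num) (by positivity) (by positivity) b4 hsx hl ?_
      rw [← sub_nonneg]
      ring_nf
      positivity
    · have b8 := truncMean_sub_step (k := 8) (by omega) hx (hstart 9 (by omega))
      have b7 := truncMean_sub_step (k := 7) (by omega) hx b8
      have b6 := truncMean_sub_step (k := 6) (by omega) hx b7
      have b5 := truncMean_sub_step (k := 5) (by omega) hx b6
      refine main_ineq_of_rational_bound (C' := 0.07) (by norm_num) hx (hcoeff _ (by norm_num))
        (by norm_num) (by positivity) (by positivity) b5 hsx hl ?_
      rw [← sub_nonneg]
      ring_nf
      positivity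

/-- The supremum `a_r'` never exceeds `a_r` once `a_r ≥ 1.55`. -/
lemma aAux_le {a : ℝ} (ha : 1.55 ≤ a) {r : ℕ} (hr : 2 ≤ r) : aAux a r ≤ a := by
  refine csSup_le ⟨_, 1, one_pos, rfl⟩ ?_
  rintro z ⟨x, hx, rfl⟩
  obtain ⟨m, rfl⟩ := Nat.exists_eq_add_of_le' hr
  have hmain := main_ineq hr hx
  rw [qProb_self (by omega) hx, qProb_self (by omega) hx]
  have hK : (0 : ℝ) < 1.55 ^ (max (m + 2) 3) - 1 := by
    have : (1 : ℝ) < 1.55 ^ (max (m + 2) 3) := one_lt_pow₀ (by norm_num) (by omega)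
    linarith
  have hA := hx.trans (lt_truncMean (n := m + 2 + 1) (by omega) hx)
  have ht := lt_truncMean (n := m + 2) (by omega) hx
  have htr := natCast_le_truncMean (n := m + 2) (by omega) hx
  have htlt := truncMean_lt (n := m + 2) (by omega) hx
  have hrecA := truncMean_recurrence (n := m + 2) (by omega) hx
  have hrecB := truncMean_recurrence (n := m + 2 - 1) (by omega) hx
  rw [show m + 2 - 1 + 1 = m + 2 by omega] at hrecB
  have hcast : ((m + 2 - 1 : ℕ) : ℝ) = ((m + 2 : ℕ) : ℝ) - 1 := by
    rw [Nat.cast_sub (by omega)]; simp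
  rw [hcast] at hrecB
  have hρ : (0 : ℝ) < ((m + 2 : ℕ) : ℝ) := by positivity
  generalize truncMean (m + 2 - 1) x = B at *
  generalize truncMean (m + 2 + 1) x = A at *
  generalize truncMean (m + 2) x = t at *
  generalize truncMean 1 x = l at *
  generalize (1.55 : ℝ) ^ (max (m + 2) 3) - 1 = K at *
  generalize ((m + 2 : ℕ) : ℝ) = ρ at *
  have ht0 : 0 < t := hx.trans ht
  have hd : 0 < ρ + x - t := by linarith
  have hmain' : (ρ + x - t) * ((t - ρ + 1) + 0.55 / K * l * ((ρ + 1) * t - ρ ^ 2) / ρ)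
      ≤ a * (t * (t - ρ)) := by
    have e : (ρ + x - t) * ((t - ρ + 1) + 0.55 / K * l * ((ρ + 1) * t - ρ ^ 2) / ρ)
        = (x - (t - ρ)) * (1 + (t - ρ) + 0.55 / K * l * (1 + (t - ρ) * ((ρ + 1) / ρ))) := by
      field_simp
      ring
    rw [e]
    have : 0 ≤ t * (t - ρ) := mul_nonneg ht0.le (by linarith)
    refine hmain.trans ?_
    rw [add_sub_cancel]
    gcongr
  have hAeq : A = ρ * x / (ρ + x - t) := by field_simp; linarith
  have hBeq : B = ρ - 1 + x - (ρ - 1) * x / t := by field_simp; linarith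
  have hgap : 0 ≤ a * A - (a + 1) * t + B
      - 0.55 / K * l * ((ρ + 1) * (1 - x / A) - ρ * (1 - x / t)) := by
    have e : a * A - (a + 1) * t + B
        - 0.55 / K * l * ((ρ + 1) * (1 - x / A) - ρ * (1 - x / t))
        = (t - x) / (t * (ρ + x - t)) * (a * (t * (t - ρ))
          - (ρ + x - t) * ((t - ρ + 1) + 0.55 / K * l * ((ρ + 1) * t - ρ ^ 2) / ρ)) := by
      rw [hAeq, hBeq]
      field_simp
      ring
    rw [e]
    exact mul_nonneg (div_nonneg (by linarith) (by positivity)) (by linarith)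
  have e : a - (a * A - (a + 1) * t + B) / A
      + 0.55 * l / (K * A) * ((ρ + 1) * (1 - x / A) - ρ * (1 - x / t))
      = a - (a * A - (a + 1) * t + B
        - 0.55 / K * l * ((ρ + 1) * (1 - x / A) - ρ * (1 - x / t))) / A := by
    field_simp
    ring
  rw [e]
  linarith [div_nonneg hgap hA.le]

lemma aSeq_succ_of_le {r : ℕ} (hr : 2 ≤ r) (h : 1.55 ≤ aSeq r) :
    aSeq (r + 1) = aSeq r + if r ≤ 24 then 0.00001 else ((2 : ℝ)⁻¹) ^ r := by
  obtain ⟨m, rfl⟩ := Nat.exists_eq_add_of_le' hr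
  rw [aSeq, max_eq_left (aAux_le h hr)]

lemma aSeq_le_succ_of_le {r : ℕ} (hr : 2 ≤ r) (h : 1.55 ≤ aSeq r) : aSeq r ≤ aSeq (r + 1) := by
  rw [aSeq_succ_of_le hr h, le_add_iff_nonneg_right]
  split_ifs <;> positivity

lemma le_aSeq {r : ℕ} (hr : 2 ≤ r) : 1.55 ≤ aSeq r := by
  induction r, hr using Nat.le_induction with
  | base => simp [aSeq]
  | succ n hn ih => exact ih.trans (aSeq_le_succ_of_le hn ih)

lemma aSeq_eq_of_le {r : ℕ} (hr : 2 ≤ r) (h25 : r ≤ 25) :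
    aSeq r = 1.55 + ((r : ℝ) - 2) * 0.00001 := by
  induction r, hr using Nat.le_induction with
  | base => simp [aSeq]
  | succ n hn ih =>
    rw [aSeq_succ_of_le hn (le_aSeq hn), if_pos (by omega), ih (by omega)]
    push_cast
    ring

lemma aSeq_le_of_ge {r : ℕ} (hr : 25 ≤ r) : aSeq r ≤ 1.5515 - 2 * (2 : ℝ)⁻¹ ^ r := by
  induction r, hr using Nat.le_induction with
  | base =>
    rw [aSeq_eq_of_le (by omega) le_rfl]
    norm_num
  | succ n hn ih =>
    rw [aSeq_succ_of_le (by omega) (le_aSeq (by omega)), if_neg (by omega), pow_succ]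
    linarith

/-- The constants `a_r` satisfy `a_2 = 1.55 ≤ a_3 ≤ a_4 ≤ …`;
`1.55 ≤ a_r ≤ 1.551` for `2 ≤ r ≤ 25`; and `1.55 ≤ a_r ≤ 1.552` for all `r ≥ 2`. -/
theorem stmt_17 :
    aSeq 2 = 1.55 ∧
    (∀ r : ℕ, 2 ≤ r → aSeq r ≤ aSeq (r + 1)) ∧
    (∀ r : ℕ, 2 ≤ r → r ≤ 25 → 1.55 ≤ aSeq r ∧ aSeq r ≤ 1.551) ∧
    (∀ r : ℕ, 2 ≤ r → 1.55 ≤ aSeq r ∧ aSeq r ≤ 1.552) := by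
  refine ⟨by simp [aSeq], fun r hr => aSeq_le_succ_of_le hr (le_aSeq hr),
    fun r hr h25 => ⟨le_aSeq hr, ?_⟩, fun r hr => ⟨le_aSeq hr, ?_⟩⟩
  · have : (r : ℝ) ≤ 25 := by exact_mod_cast h25
    rw [aSeq_eq_of_le hr h25]
    linarith
  · rcases le_total r 25 with h | h
    · have : (r : ℝ) ≤ 25 := by exact_mod_cast h
      rw [aSeq_eq_of_le hr h]
      linarith
    · have : (0 : ℝ) < 2⁻¹ ^ r := by positivity
      linarith [aSeq_le_of_ge h]
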